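/- Let X be a real n×q matrix of full column rank q, C₁ a real g×q matrix of rank g, and C₂, C, C⁽¹⁾, C⁽²⁾, P, P₁, P₂ = P₁ − P as above. For y ∈ ℝⁿ let β̂ = (XᵀX)⁻¹Xᵀy. Then the matrix C₁(XᵀX)⁻¹C₁ᵀ is invertible and yᵀ P₂ y = (C₁ β̂)ᵀ [C₁ (XᵀX)⁻¹ C₁ᵀ]⁻¹ (C₁ β̂). -/

import Mathlib

open Matrix

theorem core_aux {n q g r : ℕ} 
    (X : Matrix (Fin n) (Fin q) ℝ)
    (C₁ : Matrix (Fin g) (Fin q) ℝ) (C₂ : Matrix (Fin r) (Fin q) ℝ)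
    (E : Matrix (Fin q) (Fin g) ℝ) (D : Matrix (Fin q) (Fin r) ℝ)
    (hX : X.rank = q) (h1 : C₁ * E = 1) (h2 : C₂ * D = 1) (h3 : C₁ * D = 0)
    (h4 : E * C₁ + D * C₂ = 1) :
    IsUnit (C₁ * (Xᵀ * X)⁻¹ * C₁ᵀ) ∧
    (Xᵀ * X)⁻¹ = D * ((X * D)ᵀ * (X * D))⁻¹ * Dᵀ +
      (Xᵀ * X)⁻¹ * C₁ᵀ * (C₁ * (Xᵀ * X)⁻¹ * C₁ᵀ)⁻¹ * C₁ * (Xᵀ * X)⁻¹ := by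
  have hXinj : Function.Injective X.mulVec := by
    rw [Matrix.mulVec_injective_iff, linearIndependent_iff_card_eq_finrank_span, Set.finrank,
      ← Matrix.rank_eq_finrank_span_cols, hX, Fintype.card_fin]
  have hA : (Xᵀ * X).PosDef := by
    have := Matrix.PosDef.conjTranspose_mul_self X hXinj
    rwa [conjTranspose_eq_transpose_of_trivial] at this
  have hDinj : Function.Injective D.mulVec := by
    intro a b hab
    have := congrArg (C₂ *ᵥ ·) hab
    simpa [Matrix.mulVec_mulVec, h2] using this
  have hCinj : Function.Injective C₁ᵀ.mulVec := by
    intro a b hab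
    have := congrArg (Eᵀ *ᵥ ·) hab
    simpa [Matrix.mulVec_mulVec, ← Matrix.transpose_mul, h1] using this
  have hS : (C₁ * (Xᵀ * X)⁻¹ * C₁ᵀ).PosDef := by
    have := hA.inv.conjTranspose_mul_mul_same hCinj
    rwa [conjTranspose_eq_transpose_of_trivial, transpose_transpose] at this
  have hK : ((X * D)ᵀ * (X * D)).PosDef := by
    have := hA.conjTranspose_mul_mul_same hDinj
    rw [conjTranspose_eq_transpose_of_trivial] at this
    simpa [Matrix.transpose_mul, Matrix.mul_assoc] using this
  refine ⟨hS.isUnit, ?_⟩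
  have hAu := (Matrix.isUnit_iff_isUnit_det _).1 hA.isUnit
  have hSu := (Matrix.isUnit_iff_isUnit_det _).1 hS.isUnit
  have hKu := (Matrix.isUnit_iff_isUnit_det _).1 hK.isUnit
  have hKe : (X * D)ᵀ * (X * D) = Dᵀ * (Xᵀ * X) * D := by
    simp [Matrix.transpose_mul, Matrix.mul_assoc]
  rw [hKe] at hKu ⊢
  have hDC : Dᵀ * C₁ᵀ = 0 := by rw [← Matrix.transpose_mul, h3, Matrix.transpose_zero]
  generalize Xᵀ * X = A at *
  have hSi := Matrix.nonsing_inv_mul _ hSu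
  have hSi' := Matrix.mul_nonsing_inv _ hSu
  have hKi := Matrix.nonsing_inv_mul _ hKu
  have hAi := Matrix.mul_nonsing_inv _ hAu
  have hAi' := Matrix.nonsing_inv_mul _ hAu
  generalize (Dᵀ * A * D)⁻¹ = K at *
  generalize hSS : C₁ * A⁻¹ * C₁ᵀ = S at *
  generalize S⁻¹ = T at *
  generalize A⁻¹ = B at *
  obtain ⟨N, hN⟩ : ∃ N, N = 1 - (D * K * Dᵀ * A + B * C₁ᵀ * T * C₁) := ⟨_, rfl⟩
  have n1 : N * D = 0 := by
    have e1 : D * K * Dᵀ * A * D = D * (K * (Dᵀ * A * D)) := by simp only [Matrix.mul_assoc]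
    rw [hN, Matrix.sub_mul, Matrix.add_mul, e1, hKi, Matrix.mul_assoc _ C₁ D, h3]
    simp
  have n2 : N * (B * C₁ᵀ) = 0 := by
    have e1 : D * K * Dᵀ * A * (B * C₁ᵀ) = D * K * (Dᵀ * ((A * B) * C₁ᵀ)) := by
      simp only [Matrix.mul_assoc]
    have e2 : B * C₁ᵀ * T * C₁ * (B * C₁ᵀ) = B * C₁ᵀ * (T * (C₁ * B * C₁ᵀ)) := by
      simp only [Matrix.mul_assoc]
    rw [hN, Matrix.sub_mul, Matrix.add_mul, e1, hAi, e2, hSS, hSi, Matrix.one_mul, Matrix.one_mul, hDC]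
    simp
  have n3 : N = N * E * C₁ := by
    calc N = N * (E * C₁ + D * C₂) := by rw [h4, Matrix.mul_one]
      _ = N * E * C₁ + N * D * C₂ := by rw [Matrix.mul_add]; simp only [Matrix.mul_assoc]
      _ = _ := by rw [n1]; simp
  have n4 : N * E * S = 0 := by
    calc N * E * S = N * E * C₁ * (B * C₁ᵀ) := by rw [← hSS]; simp only [Matrix.mul_assoc]
      _ = 0 := by rw [← n3, n2]
  have n5 : N * E = 0 := by
    calc N * E = N * E * S * T := by rw [Matrix.mul_assoc _ S, hSi', Matrix.mul_one]
      _ = 0 := by rw [n4, Matrix.zero_mul]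
  have n6 : N = 0 := by rw [n3, n5, Matrix.zero_mul]
  rw [n6] at hN
  have h7 := (sub_eq_zero.1 hN.symm)
  calc B = 1 * B := by simp
    _ = D * K * Dᵀ * (A * B) + B * C₁ᵀ * T * C₁ * B := by
      rw [h7, Matrix.add_mul]; simp only [Matrix.mul_assoc]
    _ = _ := by rw [hAi, Matrix.mul_one]

/-- The hypothesis sum of squares in explicit form: with `X` of full column rank,
`C = [C₁; C₂]` (stacked) invertible, `C⁻¹ = [C⁽¹⁾ C⁽²⁾]`, `P = I − X(XᵀX)⁻¹Xᵀ`, `P₁` the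
orthogonal projection onto the orthocomplement of the column space of `X C⁽²⁾`, and
`β̂ = (XᵀX)⁻¹Xᵀy`, the matrix `C₁(XᵀX)⁻¹C₁ᵀ` is invertible and
`yᵀ(P₁ − P)y = (C₁β̂)ᵀ [C₁(XᵀX)⁻¹C₁ᵀ]⁻¹ (C₁β̂)`. -/
theorem hypothesis_sum_of_squares_formula {n q g : ℕ} (hg : g ≤ q)
    (X : Matrix (Fin n) (Fin q) ℝ)
    (C₁ : Matrix (Fin g) (Fin q) ℝ) (C₂ : Matrix (Fin (q - g)) (Fin q) ℝ)
    (hrankX : X.rank = q) (hrankC₁ : C₁.rank = g)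
    -- `C` : the stacked matrix `[C₁; C₂]`, reindexed to be square `q × q`
    (C : Matrix (Fin q) (Fin q) ℝ)
    (hCdef : C = (fromRows C₁ C₂).submatrix
      ((finSumFinEquiv.trans (finCongr (Nat.add_sub_cancel' hg))).symm) id)
    (hC : IsUnit C)
    -- `C⁽²⁾` : the last `q - g` columns of `C⁻¹`
    (C2inv : Matrix (Fin q) (Fin (q - g)) ℝ)
    (hC2inv : C2inv = (C⁻¹).submatrix id
      (fun j : Fin (q - g) => (finSumFinEquiv.trans (finCongr (Nat.add_sub_cancel' hg)))
        (Sum.inr j)))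
    (P P₁ : Matrix (Fin n) (Fin n) ℝ)
    (hP : P = 1 - X * (Xᵀ * X)⁻¹ * Xᵀ)
    (hP₁ : P₁ = 1 - (X * C2inv) * ((X * C2inv)ᵀ * (X * C2inv))⁻¹ * (X * C2inv)ᵀ)
    (y : Fin n → ℝ) (βhat : Fin q → ℝ)
    (hβhat : βhat = ((Xᵀ * X)⁻¹ * Xᵀ) *ᵥ y) :
    IsUnit (C₁ * (Xᵀ * X)⁻¹ * C₁ᵀ) ∧
    y ⬝ᵥ (P₁ - P) *ᵥ y =
      (C₁ *ᵥ βhat) ⬝ᵥ (C₁ * (Xᵀ * X)⁻¹ * C₁ᵀ)⁻¹ *ᵥ (C₁ *ᵥ βhat) := by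
  set e := finSumFinEquiv.trans (finCongr (Nat.add_sub_cancel' hg)) with he
  have hdet := (Matrix.isUnit_iff_isUnit_det _).1 hC
  have hl := Matrix.mul_nonsing_inv C hdet
  have hr := Matrix.nonsing_inv_mul C hdet
  obtain ⟨E, hE⟩ : ∃ E : Matrix (Fin q) (Fin g) ℝ,
    E = (C⁻¹).submatrix id (fun j => e (Sum.inl j)) := ⟨_, rfl⟩
  have c1 : ∀ i k, C (e (Sum.inl i)) k = C₁ i k := by
    intro i k; rw [hCdef]; simp
  have c2 : ∀ i k, C (e (Sum.inr i)) k = C₂ i k := by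
    intro i k; rw [hCdef]; simp
  have h1 : C₁ * E = 1 := by
    ext i j
    have := congrFun (congrFun hl (e (Sum.inl i))) (e (Sum.inl j))
    simp only [Matrix.mul_apply, c1] at this
    simp only [Matrix.mul_apply, hE, Matrix.submatrix_apply, id, this, Matrix.one_apply,
      e.injective.eq_iff, Sum.inl.injEq]
  have h2 : C₂ * C2inv = 1 := by
    ext i j
    have := congrFun (congrFun hl (e (Sum.inr i))) (e (Sum.inr j))
    simp only [Matrix.mul_apply, c2] at this
    simp only [Matrix.mul_apply, hC2inv, Matrix.submatrix_apply, id, this, Matrix.one_apply,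
      e.injective.eq_iff, Sum.inr.injEq]
  have h3 : C₁ * C2inv = 0 := by
    ext i j
    have := congrFun (congrFun hl (e (Sum.inl i))) (e (Sum.inr j))
    simp only [Matrix.mul_apply, c1] at this
    simp only [Matrix.mul_apply, hC2inv, Matrix.submatrix_apply, id, this, Matrix.one_apply,
      e.injective.eq_iff, reduceCtorEq, if_false, Matrix.zero_apply]
  have h4 : E * C₁ + C2inv * C₂ = 1 := by
    rw [← hr]
    ext i j
    rw [Matrix.add_apply, Matrix.mul_apply, Matrix.mul_apply, Matrix.mul_apply,
      ← e.sum_comp, Fintype.sum_sum_type]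
    simp only [c1, c2, hE, hC2inv, Matrix.submatrix_apply, id]
  obtain ⟨hu, hk⟩ := core_aux X C₁ C₂ E C2inv hrankX h1 h2 h3 h4
  refine ⟨hu, ?_⟩
  have hsymm : ((Xᵀ * X)⁻¹)ᵀ = (Xᵀ * X)⁻¹ := by
    rw [Matrix.transpose_nonsing_inv, Matrix.transpose_mul, Matrix.transpose_transpose]
  have hPP : P₁ - P = (C₁ * ((Xᵀ * X)⁻¹ * Xᵀ))ᵀ * (C₁ * (Xᵀ * X)⁻¹ * C₁ᵀ)⁻¹ *
      (C₁ * ((Xᵀ * X)⁻¹ * Xᵀ)) := by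
    rw [Matrix.transpose_mul, Matrix.transpose_mul, hsymm, Matrix.transpose_transpose, hP, hP₁,
      sub_sub_sub_cancel_left, Matrix.transpose_mul X C2inv, ← Matrix.transpose_mul X C2inv]
    generalize hS : (C₁ * (Xᵀ * X)⁻¹ * C₁ᵀ)⁻¹ = S at *
    generalize ((X * C2inv)ᵀ * (X * C2inv))⁻¹ = K at *
    have hk' := congrArg (fun M => X * M * Xᵀ) hk
    simp only [Matrix.mul_add, Matrix.add_mul] at hk'
    rw [hk', sub_eq_iff_eq_add, add_comm]
    simp only [Matrix.transpose_mul, Matrix.mul_assoc]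
  rw [hPP, hβhat, Matrix.mulVec_mulVec, ← Matrix.mulVec_mulVec, ← Matrix.mulVec_mulVec,
    Matrix.dotProduct_mulVec, Matrix.vecMul_transpose]
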